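/- Assume H > (1/2)·log a. Then for every δ > 0 and ε > 0 there exists N such that for all n ≥ N: the number of primes p with log p ≤ (1−δ)·H·n and ‖μ_n mod p − u_p‖ > ε is at most ε times the total number of primes p with log p ≤ (1−δ)·H·n. -/

import Mathlib

open scoped Classical

/-- One step of the process: the law of `b + a·Y` where `b ~ μ` and `Y ~ f` are independent,
i.e. `μ * (m_a)_* f`. -/
noncomputable def step (a : ℤ) (μ f : ℤ → ℝ) : ℤ → ℝ :=
  fun x => ∑' y : ℤ, μ (x - a * y) * f y

/-- `walk a μ n` is the law `μ_n` of `X_n`, where `X_0 = 0` and `X_{n+1} = a·X_n + b_{n+1}`. -/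
noncomputable def walk (a : ℤ) (μ : ℤ → ℝ) : ℕ → ℤ → ℝ
  | 0 => fun x => if x = 0 then 1 else 0
  | n + 1 => step a μ (walk a μ n)

/-- Reduction of a measure on `ℤ` modulo `q` (pushforward to `ZMod q`). -/
noncomputable def modq (q : ℕ) (f : ℤ → ℝ) : ZMod q → ℝ :=
  fun x => ∑' y : ℤ, if (y : ZMod q) = x then f y else 0

/-- The ℓ¹ distance `‖f mod q − u_q‖` from the reduction of `f` to the uniform measure. -/
noncomputable def distUnif (q : ℕ) (f : ℤ → ℝ) : ℝ :=
  ∑' x : ZMod q, |modq q f x - 1 / q|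

/-- Entropy of a measure on `ℤ`. -/
noncomputable def entropy (f : ℤ → ℝ) : ℝ :=
  -∑' x : ℤ, f x * Real.log (f x)

/-- `μ` is a finitely supported probability measure on `ℤ` with
`gcd(supp μ − supp μ) = 1`. -/
structure IsGoodMeasure (μ : ℤ → ℝ) : Prop where
  nonneg : ∀ x, 0 ≤ μ x
  finsupp : (Function.support μ).Finite
  total : (∑' x, μ x) = 1
  gcd_one : ∀ d : ℤ, (∀ x ∈ Function.support μ, ∀ y ∈ Function.support μ, d ∣ x - y) → IsUnit d

theorem conv_uncurry_support_finite (c : ℤ) {u v : ℤ → ℝ} (hu : u.support.Finite)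
    (hv : v.support.Finite) :
    (Function.uncurry fun x y : ℤ => u (x - c * y) * v y).support.Finite := by
  refine ((hu.prod hv).image fun z : ℤ × ℤ => (z.1 + c * z.2, z.2)).subset ?_
  rintro ⟨x, y⟩ h
  have h' : u (x - c * y) * v y ≠ 0 := h
  exact ⟨(x - c * y, y), ⟨left_ne_zero_of_mul h', right_ne_zero_of_mul h'⟩, by simp⟩

theorem tsum_tsum_conv (c : ℤ) {u v : ℤ → ℝ} (hu : u.support.Finite) (hv : v.support.Finite) :
    ∑' x, ∑' y, u (x - c * y) * v y = (∑' x, u x) * ∑' y, v y := by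
  rw [(summable_of_hasFiniteSupport (conv_uncurry_support_finite c hu hv)).tsum_comm.symm, ← tsum_mul_left]
  refine tsum_congr fun y => ?_
  rw [tsum_mul_right]
  congr 1
  exact (Equiv.subRight (c * y)).tsum_eq u

theorem step_support_finite (c : ℤ) {u v : ℤ → ℝ} (hu : u.support.Finite)
    (hv : v.support.Finite) : (step c u v).support.Finite := by
  refine (Set.Finite.image2 (fun x y => x + c * y) hu hv).subset fun x hx => ?_
  by_contra h
  apply hx
  refine (tsum_congr fun y => ?_).trans tsum_zero
  by_contra h'
  exact h ⟨x - c * y, left_ne_zero_of_mul h', y, right_ne_zero_of_mul h', by simp⟩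

/-- A finitely supported probability measure on `ℤ`. -/
structure IsFinProb (f : ℤ → ℝ) : Prop where
  nonneg : ∀ x, 0 ≤ f x
  finsupp : f.support.Finite
  total : ∑' x, f x = 1

theorem IsFinProb.step (c : ℤ) {u v : ℤ → ℝ} (hu : IsFinProb u) (hv : IsFinProb v) :
    IsFinProb (step c u v) where
  nonneg x := tsum_nonneg fun y => mul_nonneg (hu.nonneg _) (hv.nonneg _)
  finsupp := step_support_finite c hu.finsupp hv.finsupp
  total := by
    rw [show (∑' x, _root_.step c u v x) = ∑' x, ∑' y, u (x - c * y) * v y from rfl,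
      tsum_tsum_conv c hu.finsupp hv.finsupp, hu.total, hv.total, one_mul]

theorem walk_isFinProb (a : ℤ) {μ : ℤ → ℝ} (hμ : IsFinProb μ) (n : ℕ) :
    IsFinProb (walk a μ n) := by
  induction n with
  | zero =>
    refine ⟨fun x => ?_, (Set.finite_singleton (0 : ℤ)).subset fun x hx => ?_, ?_⟩
    · simp only [walk]; split_ifs <;> norm_num
    · by_contra h; exact hx (by simpa [walk] using h)
    · simp [walk]
  | succ n ih => exact hμ.step a ih

theorem IsFinProb.sum_eq_one {f : ℤ → ℝ} (hf : IsFinProb f) :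
    ∑ x ∈ hf.finsupp.toFinset, f x = 1 := by
  rw [← hf.total]
  exact (tsum_eq_sum fun x hx => by simpa using hx).symm

/-- The law of `X_{m+n}` is obtained from those of `X_m` and `X_n` by a step with factor `a ^ m`. -/
theorem walk_add (a : ℤ) {μ : ℤ → ℝ} (hμ : IsFinProb μ) (m n : ℕ) :
    walk a μ (m + n) = step (a ^ m) (walk a μ m) (walk a μ n) := by
  induction m with
  | zero =>
    funext x
    have : ∀ y, walk a μ 0 (x - a ^ 0 * y) * walk a μ n y
        = if y = x then walk a μ n y else 0 := fun y => by
      simp only [walk, pow_zero, one_mul, sub_eq_zero, eq_comm (a := x), ite_mul, zero_mul]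
    simp only [step, this, tsum_ite_eq, zero_add]
  | succ m ih =>
    funext x
    rw [show m + 1 + n = (m + n) + 1 by ring]
    have hm := walk_isFinProb a hμ m
    have hn := walk_isFinProb a hμ n
    calc walk a μ (m + n + 1) x
        = ∑' y, μ (x - a * y) * ∑' z, walk a μ m (y - a ^ m * z) * walk a μ n z := by
          rw [walk, ih]; rfl
      _ = ∑' y, ∑' z, μ (x - a * y) * (walk a μ m (y - a ^ m * z) * walk a μ n z) := by
          simp only [tsum_mul_left]
      _ = ∑' z, ∑' y, μ (x - a * y) * (walk a μ m (y - a ^ m * z) * walk a μ n z) := by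
          refine (Summable.tsum_comm ?_).symm
          apply summable_of_hasFiniteSupport
          refine (conv_uncurry_support_finite (a ^ m) hm.finsupp hn.finsupp).subset ?_
          rintro ⟨y, z⟩ h
          exact right_ne_zero_of_mul (a := μ (x - a * y)) h
      _ = ∑' z, walk a μ (m + 1) (x - a ^ (m + 1) * z) * walk a μ n z := by
          refine tsum_congr fun z => ?_
          rw [walk, step, ← tsum_mul_right, ← (Equiv.addRight (a ^ m * z)).tsum_eq]
          refine tsum_congr fun y => ?_
          simp only [Equiv.coe_addRight, add_sub_cancel_right]
          rw [show x - a * (y + a ^ m * z) = x - a ^ (m + 1) * z - a * y by ring]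
          ring

theorem rpow_tsum_le_tsum_rpow {ι : Type*} {r : ℝ} (hr0 : 0 < r) (hr1 : r ≤ 1) {h : ι → ℝ}
    (h0 : ∀ i, 0 ≤ h i) (hf : h.support.Finite) : (∑' i, h i) ^ r ≤ ∑' i, h i ^ r := by
  rw [tsum_eq_sum (s := hf.toFinset) fun i hi => by simpa using hi,
    tsum_eq_sum (s := hf.toFinset) fun i hi => by
      rw [show h i = 0 by simpa using hi, Real.zero_rpow hr0.ne']]
  induction hf.toFinset using Finset.induction_on with
  | empty => simp [Real.zero_rpow hr0.ne']
  | insert i s his ih =>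
    rw [Finset.sum_insert his, Finset.sum_insert his]
    exact (Real.rpow_add_le_add_rpow (h0 i) (Finset.sum_nonneg fun j _ => h0 j) hr0.le hr1).trans
      (by gcongr)

theorem support_rpow_finite {ι : Type*} {r : ℝ} (hr0 : 0 < r) {f : ι → ℝ}
    (hf : f.support.Finite) : (fun i => f i ^ r).support.Finite := by
  refine hf.subset fun i hi h => hi ?_
  simp [h, Real.zero_rpow hr0.ne']

theorem tsum_rpow_step_le {r : ℝ} (hr0 : 0 < r) (hr1 : r ≤ 1) (c : ℤ) {u v : ℤ → ℝ}
    (hu : IsFinProb u) (hv : IsFinProb v) :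
    ∑' x, step c u v x ^ r ≤ (∑' x, u x ^ r) * ∑' x, v x ^ r := by
  have hu' := support_rpow_finite hr0 hu.finsupp
  have hv' := support_rpow_finite hr0 hv.finsupp
  rw [← tsum_tsum_conv c hu' hv']
  refine Summable.tsum_le_tsum (fun x => ?_) ?_ ?_
  · refine (rpow_tsum_le_tsum_rpow hr0 hr1
      (fun y => mul_nonneg (hu.nonneg _) (hv.nonneg _)) ?_).trans_eq ?_
    · exact hv.finsupp.subset fun y hy => right_ne_zero_of_mul hy
    · exact tsum_congr fun y => Real.mul_rpow (hu.nonneg _) (hv.nonneg _)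
  · exact summable_of_hasFiniteSupport
      (support_rpow_finite hr0 (step_support_finite c hu.finsupp hv.finsupp))
  · exact summable_of_hasFiniteSupport (step_support_finite c hu' hv')

theorem tsum_rpow_walk_le {r : ℝ} (hr0 : 0 < r) (hr1 : r ≤ 1) (a : ℤ) {μ : ℤ → ℝ}
    (hμ : IsFinProb μ) (m k j : ℕ) :
    ∑' x, walk a μ (m * k + j) x ^ r
      ≤ (∑' x, walk a μ m x ^ r) ^ k * ∑' x, walk a μ j x ^ r := by
  induction k with
  | zero => simp
  | succ k ih =>
    rw [show m * (k + 1) + j = m + (m * k + j) by ring, walk_add a hμ, pow_succ', mul_assoc]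
    refine (tsum_rpow_step_le hr0 hr1 _ (walk_isFinProb a hμ _) (walk_isFinProb a hμ _)).trans ?_
    gcongr
    exact tsum_nonneg fun x => Real.rpow_nonneg ((walk_isFinProb a hμ m).nonneg x) r

theorem IsFinProb.entropy_eq_sum {f : ℤ → ℝ} (hf : IsFinProb f) :
    entropy f = ∑ x ∈ hf.finsupp.toFinset, f x * -Real.log (f x) := by
  rw [entropy, tsum_eq_sum (s := hf.finsupp.toFinset), ← Finset.sum_neg_distrib]
  · simp
  · intro x hx
    rw [show f x = 0 by simpa using hx, zero_mul]

theorem IsFinProb.tsum_rpow_eq_sum {f : ℤ → ℝ} (hf : IsFinProb f) {s : ℝ} (hs : s < 1) :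
    ∑' x, f x ^ (1 - s) = ∑ x ∈ hf.finsupp.toFinset, f x * Real.exp (s * -Real.log (f x)) := by
  rw [tsum_eq_sum (s := hf.finsupp.toFinset)]
  · refine Finset.sum_congr rfl fun x hx => ?_
    have hx0 : 0 < f x := (hf.nonneg x).lt_of_ne' (by simpa using hx)
    rw [Real.rpow_sub hx0, Real.rpow_one, Real.rpow_def_of_pos hx0, div_eq_mul_inv, ← Real.exp_neg]
    ring_nf
  · intro x hx
    rw [show f x = 0 by simpa using hx, Real.zero_rpow (by linarith)]

/-- For small `s > 0`, the sum `∑ f ^ (1 - s)` is at most `exp (s (H(f) + η))`. -/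
theorem IsFinProb.exists_tsum_rpow_le {f : ℤ → ℝ} (hf : IsFinProb f) {η : ℝ} (hη : 0 < η) :
    ∃ s : ℝ, 0 < s ∧ s < 1 ∧ ∑' x, f x ^ (1 - s) ≤ Real.exp (s * (entropy f + η)) := by
  obtain ⟨B, hB⟩ : ∃ B : ℝ, ∀ x ∈ hf.finsupp.toFinset, |-Real.log (f x)| ≤ B := by
    obtain ⟨B, hB⟩ := (hf.finsupp.toFinset.image fun x => |-Real.log (f x)|).bddAbove
    exact ⟨B, fun x hx => hB (Finset.mem_coe.2 (Finset.mem_image_of_mem _ hx))⟩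
  set b := max B 1 with hb
  have hb1 : 1 ≤ b := le_max_right _ _
  set s := min (1 / (2 * b)) (η / b ^ 2) with hs
  have hs0 : 0 < s := lt_min (by positivity) (by positivity)
  have hsb : s * b ≤ 1 := by
    have : s * (2 * b) ≤ 1 := (le_div_iff₀ (by positivity)).1 (min_le_left _ _)
    nlinarith
  have hs1 : s < 1 := by
    have : s * (2 * b) ≤ 1 := (le_div_iff₀ (by positivity)).1 (min_le_left _ _)
    nlinarith
  have hsb2 : s * b ^ 2 ≤ η := (le_div_iff₀ (by positivity)).1 (min_le_right _ _)
  refine ⟨s, hs0, hs1, ?_⟩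
  rw [hf.tsum_rpow_eq_sum hs1]
  calc ∑ x ∈ hf.finsupp.toFinset, f x * Real.exp (s * -Real.log (f x))
      ≤ ∑ x ∈ hf.finsupp.toFinset, (f x * (1 + s * η) + s * (f x * -Real.log (f x))) := by
        refine Finset.sum_le_sum fun x hx => ?_
        set l := -Real.log (f x)
        have hl : |l| ≤ b := (hB x hx).trans (le_max_left _ _)
        have hsl : |s * l| ≤ 1 := by
          rw [abs_mul, abs_of_pos hs0]
          exact (mul_le_mul_of_nonneg_left hl hs0.le).trans hsb
        have h1 := (abs_le.1 (Real.abs_exp_sub_one_sub_id_le hsl)).2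
        have h2 : l ^ 2 ≤ b ^ 2 := sq_le_sq' (by linarith [(abs_le.1 hl).1]) (abs_le.1 hl).2
        have h3 : (s * l) ^ 2 ≤ s * η := by nlinarith [mul_pos hs0 hs0]
        have h4 : Real.exp (s * l) ≤ (1 + s * η) + s * l := by linarith
        nlinarith [mul_le_mul_of_nonneg_left h4 (hf.nonneg x)]
    _ = s * (entropy f + η) + 1 := by
        rw [Finset.sum_add_distrib, ← Finset.sum_mul, ← Finset.mul_sum, hf.sum_eq_one,
          hf.entropy_eq_sum]
        ring
    _ ≤ _ := Real.add_one_le_exp _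

/-- Mass of the points where `f` is large, in terms of entropy and `∑ f ^ (1 - s)`. -/
theorem IsFinProb.mul_tsum_large_le {f : ℤ → ℝ} (hf : IsFinProb f) {s : ℝ} (hs0 : 0 < s)
    (hs1 : s < 1) (A : ℝ) {T : ℝ} :
    T * ∑' x, (if Real.exp (-(A - T)) < f x then f x else 0)
      ≤ A - entropy f + Real.exp (-(s * A)) / s * ∑' x, f x ^ (1 - s) := by
  rw [hf.tsum_rpow_eq_sum hs1, hf.entropy_eq_sum,
    tsum_eq_sum (s := hf.finsupp.toFinset) fun x hx => by
      rw [show f x = 0 by simpa using hx, ite_self]]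
  have hA : A = ∑ x ∈ hf.finsupp.toFinset, f x * A := by
    rw [← Finset.sum_mul, hf.sum_eq_one, one_mul]
  conv_rhs => enter [1, 1]; rw [hA]
  rw [Finset.mul_sum, Finset.mul_sum, ← Finset.sum_sub_distrib, ← Finset.sum_add_distrib]
  refine Finset.sum_le_sum fun x hx => ?_
  have hx0 : 0 < f x := (hf.nonneg x).lt_of_ne' (by simpa using hx)
  have hrw : Real.exp (-(s * A)) / s * (f x * Real.exp (s * -Real.log (f x)))
      = f x * (Real.exp (s * (-Real.log (f x) - A)) / s) := by
    rw [mul_sub, sub_eq_add_neg, Real.exp_add]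
    ring
  rw [hrw]
  have hexp : -Real.log (f x) - A ≤ Real.exp (s * (-Real.log (f x) - A)) / s := by
    rw [le_div_iff₀ hs0]
    linarith [Real.add_one_le_exp (s * (-Real.log (f x) - A))]
  split_ifs with h
  · have h1 : -(A - T) < Real.log (f x) := (Real.lt_log_iff_exp_lt hx0).2 h
    have h2 : 0 < Real.exp (s * (-Real.log (f x) - A)) / s := by positivity
    nlinarith
  · nlinarith

open Filter in
/-- Asymptotic equipartition: for the walk, points of mass larger than `exp (-(H - t) n)` carry
little mass. -/
theorem eventually_tsum_large_le (a : ℤ) {μ : ℤ → ℝ} (hμ : IsFinProb μ) {H : ℝ} (hH0 : 0 ≤ H)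
    (hH : Tendsto (fun n : ℕ => entropy (walk a μ n) / n) atTop (nhds H))
    {t ε : ℝ} (ht : 0 < t) (hε : 0 < ε) :
    ∀ᶠ n : ℕ in atTop, ∑' x, (if Real.exp (-((H - t) * n)) < walk a μ n x then walk a μ n x else 0)
      ≤ ε := by
  set η := t * ε / 5 with hη
  have hη0 : 0 < η := by positivity
  obtain ⟨m, hm, hm0⟩ : ∃ m : ℕ, entropy (walk a μ m) / m < H + η ∧ 0 < m :=
    ((hH.eventually_lt_const (lt_add_of_pos_right H hη0)).and (eventually_gt_atTop 0)).exists
  have hm0' : (0 : ℝ) < m := by exact_mod_cast hm0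
  rw [div_lt_iff₀ hm0'] at hm
  obtain ⟨s, hs0, hs1, hs⟩ := (walk_isFinProb a hμ m).exists_tsum_rpow_le (mul_pos hη0 hm0')
  have hnn : ∀ n, 0 ≤ ∑' x, walk a μ n x ^ (1 - s) := fun n =>
    tsum_nonneg fun x => Real.rpow_nonneg ((walk_isFinProb a hμ n).nonneg x) _
  set C := ∑ j ∈ Finset.range m, ∑' x, walk a μ j x ^ (1 - s) with hC
  have hC0 : 0 ≤ C := Finset.sum_nonneg fun j _ => hnn j
  have hbound : ∀ n : ℕ, ∑' x, walk a μ n x ^ (1 - s) ≤ Real.exp (s * ((H + 2 * η) * n)) * C := by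
    intro n
    have h1 := tsum_rpow_walk_le (r := 1 - s) (by linarith) (by linarith) a hμ m (n / m) (n % m)
    rw [Nat.div_add_mod] at h1
    refine h1.trans ?_
    gcongr
    · exact hnn _
    · calc (∑' x, walk a μ m x ^ (1 - s)) ^ (n / m)
          ≤ Real.exp (s * ((H + 2 * η) * m)) ^ (n / m) := by
            refine pow_le_pow_left₀ (hnn m) (hs.trans ?_) _
            gcongr
            linarith
        _ = Real.exp (s * ((H + 2 * η) * (m * (n / m : ℕ)))) := by
            rw [← Real.exp_nat_mul]; ring_nf
        _ ≤ _ := by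
            gcongr
            exact_mod_cast Nat.mul_div_le n m
    · exact Finset.single_le_sum (f := fun j => ∑' x, walk a μ j x ^ (1 - s))
        (fun j _ => hnn j) (Finset.mem_range.2 (Nat.mod_lt _ hm0))
  have hlarge : ∀ᶠ n : ℕ in atTop, C / s / η ≤ n :=
    tendsto_natCast_atTop_atTop.eventually_ge_atTop _
  filter_upwards [hH.eventually_const_lt (sub_lt_self H hη0), eventually_gt_atTop 0, hlarge]
    with n hn hn0 hnC
  have hn0' : (0 : ℝ) < n := by exact_mod_cast hn0
  rw [lt_div_iff₀ hn0'] at hn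
  rw [div_le_iff₀ hη0] at hnC
  have hf := walk_isFinProb a hμ n
  have key := hf.mul_tsum_large_le hs0 hs1 ((H + 2 * η) * n) (T := t * n)
  have h2 : Real.exp (-(s * ((H + 2 * η) * n))) / s * ∑' x, walk a μ n x ^ (1 - s) ≤ C / s := by
    calc _ ≤ Real.exp (-(s * ((H + 2 * η) * n))) / s * (Real.exp (s * ((H + 2 * η) * n)) * C) := by
          gcongr; exact hbound n
      _ = Real.exp (-(s * ((H + 2 * η) * n)) + s * ((H + 2 * η) * n)) * C / s := by
          rw [Real.exp_add]; ring
      _ = C / s := by simp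
  have h3 : ∑' x, (if Real.exp (-((H - t) * n)) < walk a μ n x then walk a μ n x else 0)
      ≤ ∑' x, (if Real.exp (-((H + 2 * η) * n - t * n)) < walk a μ n x then walk a μ n x else 0) := by
    refine Summable.tsum_le_tsum (fun x => ?_) ?_ ?_
    · have : Real.exp (-((H + 2 * η) * n - t * n)) ≤ Real.exp (-((H - t) * n)) := by
        gcongr
        nlinarith
      split_ifs with h h'
      · rfl
      · exact absurd (this.trans_lt h) h'
      · exact hf.nonneg x
      · rfl
    all_goals
      refine summable_of_hasFiniteSupport (hf.finsupp.subset fun x hx h => hx ?_)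
      simp [h]
  refine h3.trans (le_of_mul_le_mul_left (key.trans ?_) (mul_pos ht hn0'))
  have : t * n * ε = 5 * η * n := by rw [hη]; ring
  nlinarith

/-- The additive character `θ ↦ exp (2π i θ)`. -/
noncomputable def expTwoPi (θ : ℝ) : ℂ := Complex.exp ((2 * Real.pi * θ : ℝ) * Complex.I)

theorem expTwoPi_add (x y : ℝ) : expTwoPi (x + y) = expTwoPi x * expTwoPi y := by
  simp only [expTwoPi, ← Complex.exp_add]
  push_cast
  ring_nf

theorem norm_expTwoPi (x : ℝ) : ‖expTwoPi x‖ = 1 := Complex.norm_exp_ofReal_mul_I _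

theorem conj_expTwoPi (x : ℝ) : (starRingEnd ℂ) (expTwoPi x) = expTwoPi (-x) := by
  rw [expTwoPi, expTwoPi, ← Complex.exp_conj, map_mul, Complex.conj_ofReal, Complex.conj_I]
  push_cast
  ring_nf

theorem expTwoPi_natCast_mul (n : ℕ) (x : ℝ) : expTwoPi (n * x) = expTwoPi x ^ n := by
  rw [expTwoPi, expTwoPi, ← Complex.exp_nat_mul]
  push_cast
  ring_nf

theorem expTwoPi_eq_one_iff (x : ℝ) : expTwoPi x = 1 ↔ ∃ n : ℤ, x = n := by
  rw [expTwoPi, Complex.exp_eq_one_iff]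
  refine exists_congr fun n => ?_
  have h : (2 * Real.pi * Complex.I : ℂ) ≠ 0 := Complex.two_pi_I_ne_zero
  constructor
  · intro hx
    have : (2 * Real.pi * Complex.I : ℂ) * x = (2 * Real.pi * Complex.I) * n := by
      push_cast at hx
      linear_combination hx
    exact_mod_cast mul_left_cancel₀ h this
  · rintro rfl
    push_cast
    ring

theorem expTwoPi_intCast (n : ℤ) : expTwoPi n = 1 := (expTwoPi_eq_one_iff _).2 ⟨n, rfl⟩

theorem expTwoPi_fract (x : ℝ) : expTwoPi (Int.fract x) = expTwoPi x := by
  conv_rhs => rw [← Int.fract_add_floor x, expTwoPi_add, expTwoPi_intCast, mul_one]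

theorem four_mul_abs_le_norm_expTwoPi_sub_one {t : ℝ} (ht : |t| ≤ 1 / 2) :
    4 * |t| ≤ ‖expTwoPi t - 1‖ := by
  have hpi := Real.pi_pos
  have h1 : ‖expTwoPi t - 1‖ ^ 2 = 2 - 2 * Real.cos (2 * Real.pi * t) := by
    rw [← Complex.normSq_eq_norm_sq, Complex.normSq_apply, expTwoPi, Complex.sub_re,
      Complex.sub_im, Complex.exp_ofReal_mul_I_re, Complex.exp_ofReal_mul_I_im, Complex.one_re,
      Complex.one_im]
    nlinarith [Real.sin_sq_add_cos_sq (2 * Real.pi * t)]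
  have h3 : Real.cos (2 * Real.pi * t) ≤ 1 - 2 / Real.pi ^ 2 * (2 * Real.pi * t) ^ 2 := by
    apply Real.cos_le_one_sub_mul_cos_sq
    rw [abs_mul, abs_of_pos (by positivity)]
    nlinarith
  have h4 : 2 / Real.pi ^ 2 * (2 * Real.pi * t) ^ 2 = 8 * t ^ 2 := by
    field_simp
    ring
  refine abs_le_of_sq_le_sq' ?_ (norm_nonneg _) |>.2
  rw [mul_pow, sq_abs]
  linarith

theorem norm_sum_expTwoPi_le_card (S : Finset ℤ) (θ : ℝ) :
    ‖∑ x ∈ S, expTwoPi (x * θ)‖ ≤ S.card := by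
  refine (norm_sum_le _ _).trans ?_
  simp [norm_expTwoPi]

theorem norm_sum_expTwoPi_le (M : ℕ) {θ : ℝ} (hθ : 0 < Int.fract θ) :
    ‖∑ x ∈ Finset.Icc (-M : ℤ) M, expTwoPi (x * θ)‖
      ≤ 1 / Int.fract θ + 1 / (1 - Int.fract θ) := by
  set t := Int.fract θ with ht
  have ht1 : t < 1 := Int.fract_lt_one θ
  have hz : ∀ x : ℤ, expTwoPi (x * θ) = expTwoPi (-M * θ) * expTwoPi θ ^ (x + M).toNat ∨
      x + M < 0 := by
    intro x
    rcases lt_or_ge (x + M) 0 with h | h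
    · exact Or.inr h
    · left
      rw [← expTwoPi_natCast_mul, ← expTwoPi_add]
      congr 1
      have : (((x + M).toNat : ℤ) : ℝ) = x + M := by rw [Int.toNat_of_nonneg h]; push_cast; rfl
      rw [Int.cast_natCast] at this
      rw [this]
      ring
  have hsum : ∑ x ∈ Finset.Icc (-M : ℤ) M, expTwoPi (x * θ)
      = expTwoPi (-M * θ) * ∑ j ∈ Finset.range (2 * M + 1), expTwoPi θ ^ j := by
    rw [Finset.mul_sum]
    refine Finset.sum_nbij' (fun x => (x + M).toNat) (fun j => (j : ℤ) - M) ?_ ?_ ?_ ?_ ?_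
    · intro x hx; simp only [Finset.mem_Icc, Finset.mem_range] at *; omega
    · intro x hx; simp only [Finset.mem_Icc, Finset.mem_range] at *; omega
    · intro x hx; simp only [Finset.mem_Icc] at *; omega
    · intro x hx; simp only [Finset.mem_range] at *; omega
    · intro x hx
      rw [Finset.mem_Icc] at hx
      exact (hz x).resolve_right (by omega)
  have hne : expTwoPi θ ≠ 1 := by
    rw [← expTwoPi_fract]
    intro h
    obtain ⟨n, hn⟩ := (expTwoPi_eq_one_iff _).1 h
    rw [← ht] at hn
    have h1 : (0 : ℤ) < n := by exact_mod_cast hn ▸ hθ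
    have h2 : n < (1 : ℤ) := by exact_mod_cast hn ▸ ht1
    omega
  have hpos : 0 < ‖expTwoPi θ - 1‖ := norm_pos_iff.2 (sub_ne_zero.2 hne)
  rw [hsum, norm_mul, norm_expTwoPi, one_mul, geom_sum_eq hne, norm_div]
  have hnum : ‖expTwoPi θ ^ (2 * M + 1) - 1‖ ≤ 2 := by
    refine (norm_sub_le _ _).trans ?_
    rw [norm_pow, norm_expTwoPi]
    norm_num
  have h1t : 0 < 1 - t := by linarith
  have hden : 4 * t ≤ ‖expTwoPi θ - 1‖ ∨ 4 * (1 - t) ≤ ‖expTwoPi θ - 1‖ := by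
    rcases le_total t (1 / 2) with h | h
    · left
      have := four_mul_abs_le_norm_expTwoPi_sub_one (t := t) (by rwa [abs_of_pos hθ])
      rwa [ht, expTwoPi_fract, ← ht, abs_of_pos hθ] at this
    · right
      have := four_mul_abs_le_norm_expTwoPi_sub_one (t := t - 1)
        (by rw [abs_of_neg (by linarith)]; linarith)
      rw [show t - 1 = t + ((-1 : ℤ) : ℝ) by push_cast; ring, expTwoPi_add, expTwoPi_intCast,
        mul_one, ht, expTwoPi_fract, ← ht, abs_of_neg (by push_cast; linarith)] at this
      push_cast at this
      linarith
  rw [div_le_iff₀ hpos]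
  refine hnum.trans ?_
  rcases hden with h | h
  · have h5 : 2 ≤ 1 / t * ‖expTwoPi θ - 1‖ := by
      rw [one_div, inv_mul_eq_div, le_div_iff₀ hθ]; linarith
    have h6 : 0 ≤ 1 / (1 - t) * ‖expTwoPi θ - 1‖ := by positivity
    linarith
  · have h5 : 2 ≤ 1 / (1 - t) * ‖expTwoPi θ - 1‖ := by
      rw [one_div, inv_mul_eq_div, le_div_iff₀ h1t]; linarith
    have h6 : 0 ≤ 1 / t * ‖expTwoPi θ - 1‖ := by positivity
    linarith

open ComplexConjugate in
/-- The large sieve inequality in dual form, with a bound `B` for the rows of the kernel matrix. -/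
theorem large_sieve_of_kernel_bound {ι : Type*} (R : Finset ι) (α : ι → ℝ) (S : Finset ℤ)
    (g : ℤ → ℝ) {B : ℝ} (hB0 : 0 ≤ B)
    (hB : ∀ r ∈ R, ∑ s ∈ R, ‖∑ x ∈ S, expTwoPi (x * (α r - α s))‖ ≤ B) :
    ∑ r ∈ R, ‖∑ x ∈ S, (g x : ℂ) * expTwoPi (x * α r)‖ ^ 2 ≤ B * ∑ x ∈ S, g x ^ 2 := by
  set A : ι → ℂ := fun r => ∑ x ∈ S, (g x : ℂ) * expTwoPi (x * α r) with hA
  set T := ∑ r ∈ R, ‖A r‖ ^ 2 with hT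
  have hT0 : 0 ≤ T := Finset.sum_nonneg fun r _ => sq_nonneg _
  set G := ∑ x ∈ S, g x ^ 2 with hG
  have hG0 : 0 ≤ G := Finset.sum_nonneg fun r _ => sq_nonneg _
  set D : ι → ι → ℝ := fun r s => ‖∑ x ∈ S, expTwoPi (x * (α r - α s))‖ with hD
  have hDsymm : ∀ r s, D r s = D s r := by
    intro r s
    simp only [hD]
    rw [← RCLike.norm_conj, map_sum]
    congr 1
    refine Finset.sum_congr rfl fun x _ => ?_
    rw [conj_expTwoPi]
    ring_nf
  set U : ℤ → ℂ := fun x => ∑ r ∈ R, conj (A r) * expTwoPi (x * α r) with hU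
  have hTU : (T : ℂ) = ∑ x ∈ S, (g x : ℂ) * U x := by
    simp only [hU, Finset.mul_sum]
    rw [Finset.sum_comm, hT]
    push_cast
    refine Finset.sum_congr rfl fun r _ => ?_
    rw [← Complex.conj_mul', hA, Finset.mul_sum]
    exact Finset.sum_congr rfl fun x _ => by ring
  have hTle : T ≤ ∑ x ∈ S, |g x| * ‖U x‖ := by
    calc T = ‖(T : ℂ)‖ := by rw [Complex.norm_real, Real.norm_of_nonneg hT0]
      _ ≤ ∑ x ∈ S, ‖(g x : ℂ) * U x‖ := hTU ▸ norm_sum_le _ _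
      _ = _ := by simp
  have hCS : T ^ 2 ≤ G * ∑ x ∈ S, ‖U x‖ ^ 2 := by
    refine (pow_le_pow_left₀ hT0 hTle 2).trans
      ((Finset.sum_mul_sq_le_sq_mul_sq S _ _).trans_eq ?_)
    simp [hG]
  have hUU : ((∑ x ∈ S, ‖U x‖ ^ 2 : ℝ) : ℂ)
      = ∑ r ∈ R, ∑ s ∈ R, conj (A r) * A s * ∑ x ∈ S, expTwoPi (x * (α r - α s)) := by
    push_cast
    simp only [Finset.mul_sum]
    rw [Finset.sum_congr rfl fun r _ => Finset.sum_comm, Finset.sum_comm]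
    refine Finset.sum_congr rfl fun x _ => ?_
    rw [← Complex.mul_conj', hU, map_sum, Finset.sum_mul_sum]
    refine Finset.sum_congr rfl fun r _ => Finset.sum_congr rfl fun s _ => ?_
    rw [mul_sub, sub_eq_add_neg, expTwoPi_add, map_mul, conj_expTwoPi, Complex.conj_conj]
    ring
  have hUle : ∑ x ∈ S, ‖U x‖ ^ 2 ≤ B * T := by
    calc ∑ x ∈ S, ‖U x‖ ^ 2 = ‖((∑ x ∈ S, ‖U x‖ ^ 2 : ℝ) : ℂ)‖ := by
          rw [Complex.norm_real,
            Real.norm_of_nonneg (Finset.sum_nonneg fun r _ => sq_nonneg _)]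
      _ ≤ ∑ r ∈ R, ∑ s ∈ R, ‖A r‖ * ‖A s‖ * D r s := by
          rw [hUU]
          refine (norm_sum_le _ _).trans (Finset.sum_le_sum fun r _ =>
            (norm_sum_le _ _).trans_eq (Finset.sum_congr rfl fun s _ => ?_))
          rw [norm_mul, norm_mul, RCLike.norm_conj]
      _ ≤ ∑ r ∈ R, ∑ s ∈ R, (‖A r‖ ^ 2 * D r s / 2 + ‖A s‖ ^ 2 * D s r / 2) := by
          refine Finset.sum_le_sum fun r _ => Finset.sum_le_sum fun s _ => ?_
          rw [hDsymm s r]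
          have : 0 ≤ D r s := norm_nonneg _
          nlinarith [mul_nonneg (sq_nonneg (‖A r‖ - ‖A s‖)) this]
      _ = ∑ r ∈ R, ‖A r‖ ^ 2 * ∑ s ∈ R, D r s := by
          simp only [Finset.sum_add_distrib]
          rw [Finset.sum_comm (f := fun r s => ‖A s‖ ^ 2 * D s r / 2), ← Finset.sum_add_distrib]
          refine Finset.sum_congr rfl fun r _ => ?_
          rw [← Finset.sum_add_distrib, Finset.mul_sum]
          exact Finset.sum_congr rfl fun s _ => by ring
      _ ≤ ∑ r ∈ R, ‖A r‖ ^ 2 * B :=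
          Finset.sum_le_sum fun r hr => mul_le_mul_of_nonneg_left (hB r hr) (sq_nonneg _)
      _ = B * T := by rw [← Finset.sum_mul, mul_comm]
  rcases hT0.eq_or_lt with h | h
  · rw [← h]
    exact mul_nonneg hB0 hG0
  · refine le_of_mul_le_mul_left ?_ h
    nlinarith [mul_le_mul_of_nonneg_left hUle hG0]

theorem sum_one_div_fract_le {ι : Type*} (R : Finset ι) (β : ι → ℝ) (K : ℕ) (hK : 0 < K)
    (h0 : ∀ s ∈ R, 1 / (K : ℝ) ≤ Int.fract (β s))
    (hsep : ∀ s ∈ R, ∀ s' ∈ R, s ≠ s' → ∀ k : ℤ, 1 / (K : ℝ) ≤ |β s - β s' - k|) :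
    ∑ s ∈ R, 1 / Int.fract (β s) ≤ K * (1 + Real.log K) := by
  have hK' : (0 : ℝ) < K := by exact_mod_cast hK
  set κ : ι → ℕ := fun s => ⌊K * Int.fract (β s)⌋₊ with hκ
  have hκ1 : ∀ s ∈ R, 1 ≤ κ s := fun s hs => by
    rw [hκ, Nat.one_le_floor_iff]
    have := h0 s hs
    rwa [div_le_iff₀ hK', mul_comm] at this
  have hκK : ∀ s ∈ R, κ s ≤ K := fun s _ => by
    refine Nat.floor_le_of_le ?_
    nlinarith [Int.fract_lt_one (β s)]
  have hinj : Set.InjOn κ R := by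
    intro s hs s' hs' h
    by_contra hne
    have h1 := hsep s hs s' hs' hne (⌊β s⌋ - ⌊β s'⌋)
    have h2 : β s - β s' - ((⌊β s⌋ - ⌊β s'⌋ : ℤ) : ℝ) = Int.fract (β s) - Int.fract (β s') := by
      rw [Int.fract, Int.fract]; push_cast; ring
    rw [h2, div_le_iff₀ hK'] at h1
    have a1 := Nat.floor_le (mul_nonneg hK'.le (Int.fract_nonneg (β s)))
    have a2 := Nat.lt_floor_add_one (K * Int.fract (β s))
    have b1 := Nat.floor_le (mul_nonneg hK'.le (Int.fract_nonneg (β s')))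
    have b2 := Nat.lt_floor_add_one (K * Int.fract (β s'))
    have hc : (⌊K * Int.fract (β s)⌋₊ : ℝ) = ⌊K * Int.fract (β s')⌋₊ := by exact_mod_cast h
    rw [← hc] at b1 b2
    have h3 : |Int.fract (β s) - Int.fract (β s')| * K < 1 := by
      rw [← abs_of_pos hK', ← abs_mul, abs_lt]
      constructor <;> nlinarith
    linarith
  calc ∑ s ∈ R, 1 / Int.fract (β s) ≤ ∑ s ∈ R, K * ((κ s : ℝ))⁻¹ := by
        refine Finset.sum_le_sum fun s hs => ?_
        have h1 : (1 : ℝ) ≤ κ s := by exact_mod_cast hκ1 s hs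
        have h2 : 0 < Int.fract (β s) := (by positivity : 0 < 1 / (K : ℝ)).trans_le (h0 s hs)
        have h3 : (κ s : ℝ) ≤ K * Int.fract (β s) := Nat.floor_le (by positivity)
        rw [← div_eq_mul_inv, div_le_div_iff₀ h2 (by linarith)]
        linarith
    _ = ∑ k ∈ R.image κ, K * ((k : ℝ))⁻¹ := by rw [Finset.sum_image hinj]
    _ ≤ ∑ k ∈ Finset.Icc 1 K, K * ((k : ℝ))⁻¹ := by
        refine Finset.sum_le_sum_of_subset_of_nonneg ?_ fun k _ _ => by positivity
        intro k hk
        obtain ⟨s, hs, rfl⟩ := Finset.mem_image.1 hk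
        exact Finset.mem_Icc.2 ⟨hκ1 s hs, hκK s hs⟩
    _ ≤ K * (1 + Real.log K) := by
        rw [← Finset.mul_sum]
        gcongr
        have := harmonic_le_one_add_log K
        rw [harmonic_eq_sum_Icc] at this
        push_cast at this
        exact this

/-- The large sieve inequality for points that are `1 / K`-separated modulo `1`. -/
theorem large_sieve_of_separated {ι : Type*} (R : Finset ι) (α : ι → ℝ) (M K : ℕ) (hK : 0 < K)
    (hsep : ∀ r ∈ R, ∀ s ∈ R, r ≠ s → ∀ k : ℤ, 1 / (K : ℝ) ≤ |α r - α s - k|) (g : ℤ → ℝ) :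
    ∑ r ∈ R, ‖∑ x ∈ Finset.Icc (-M : ℤ) M, (g x : ℂ) * expTwoPi (x * α r)‖ ^ 2
      ≤ ((2 * M + 1) + 2 * (K * (1 + Real.log K))) * ∑ x ∈ Finset.Icc (-M : ℤ) M, g x ^ 2 := by
  classical
  have hK' : (0 : ℝ) < K := by exact_mod_cast hK
  have hlog : 0 ≤ Real.log K := Real.log_natCast_nonneg K
  refine large_sieve_of_kernel_bound R α _ g (by positivity) fun r hr => ?_
  rw [← Finset.add_sum_erase R _ hr]
  refine add_le_add ((norm_sum_expTwoPi_le_card _ _).trans_eq ?_) ?_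
  · rw [Int.card_Icc]
    have : ((M : ℤ) + 1 - -M).toNat = 2 * M + 1 := by omega
    rw [this]; push_cast; ring
  have hfr : ∀ r ∈ R, ∀ s ∈ R, r ≠ s → 1 / (K : ℝ) ≤ Int.fract (α r - α s) := by
    intro r hr s hs hne
    have := hsep r hr s hs hne ⌊α r - α s⌋
    rwa [Int.self_sub_floor, abs_of_nonneg (Int.fract_nonneg _)] at this
  have hKpos : 0 < 1 / (K : ℝ) := by positivity
  calc ∑ s ∈ R.erase r, ‖∑ x ∈ Finset.Icc (-M : ℤ) M, expTwoPi (x * (α r - α s))‖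
      ≤ ∑ s ∈ R.erase r, (1 / Int.fract (α r - α s) + 1 / Int.fract (α s - α r)) := by
        refine Finset.sum_le_sum fun s hs => ?_
        obtain ⟨hne, hs⟩ := Finset.mem_erase.1 hs
        have h1 := hKpos.trans_le (hfr r hr s hs hne.symm)
        refine (norm_sum_expTwoPi_le M h1).trans_eq ?_
        rw [← neg_sub (α r) (α s), Int.fract_neg h1.ne']
    _ = ∑ s ∈ R.erase r, 1 / Int.fract (α r - α s)
        + ∑ s ∈ R.erase r, 1 / Int.fract (α s - α r) := Finset.sum_add_distrib
    _ ≤ K * (1 + Real.log K) + K * (1 + Real.log K) := by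
        refine add_le_add (sum_one_div_fract_le _ _ K hK ?_ ?_) (sum_one_div_fract_le _ _ K hK ?_ ?_)
        · intro s hs
          obtain ⟨hne, hs⟩ := Finset.mem_erase.1 hs
          exact hfr r hr s hs hne.symm
        · intro s hs s' hs' hne k
          have := hsep s' (Finset.mem_of_mem_erase hs') s (Finset.mem_of_mem_erase hs) hne.symm k
          rwa [show α r - α s - (α r - α s') - k = α s' - α s - k by ring]
        · intro s hs
          obtain ⟨hne, hs⟩ := Finset.mem_erase.1 hs
          exact hfr s hs r hr hne
        · intro s hs s' hs' hne k
          have := hsep s (Finset.mem_of_mem_erase hs) s' (Finset.mem_of_mem_erase hs') hne k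
          rwa [show α s - α r - (α s' - α r) - k = α s - α s' - k by ring]
    _ = _ := by ring

/-- The large sieve inequality for prime moduli. -/
theorem large_sieve_primes (P : Finset ℕ) (Q : ℕ) (hQ : 0 < Q)
    (hP : ∀ p ∈ P, p.Prime ∧ p ≤ Q) (M : ℕ) (g : ℤ → ℝ) :
    ∑ p ∈ P, ∑ ξ ∈ Finset.Ico 1 p,
        ‖∑ x ∈ Finset.Icc (-M : ℤ) M, (g x : ℂ) * expTwoPi (x * ((ξ : ℝ) / p))‖ ^ 2
      ≤ ((2 * M + 1) + 2 * ((Q ^ 2 : ℕ) * (1 + Real.log (Q ^ 2 : ℕ))))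
        * ∑ x ∈ Finset.Icc (-M : ℤ) M, g x ^ 2 := by
  rw [Finset.sum_sigma']
  refine large_sieve_of_separated _ (fun z : (_ : ℕ) × ℕ => (z.2 : ℝ) / z.1) M (Q ^ 2)
    (by positivity) ?_ g
  rintro ⟨p, ξ⟩ h ⟨p', ξ'⟩ h' hne k
  simp only [Finset.mem_sigma, Finset.mem_Ico] at h h'
  obtain ⟨hp, hξ1, hξp⟩ := h
  obtain ⟨hp', hξ1', hξp'⟩ := h'
  obtain ⟨hp, hpQ⟩ := hP p hp
  obtain ⟨hp', hpQ'⟩ := hP p' hp'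
  have hp0 : (0 : ℝ) < p := by exact_mod_cast hp.pos
  have hp0' : (0 : ℝ) < p' := by exact_mod_cast hp'.pos
  have hnum : ((ξ * p' - ξ' * p - k * p * p' : ℤ)) ≠ 0 := by
    intro h0
    have hdvd : (p : ℤ) ∣ ξ * p' := ⟨ξ' + k * p', by linear_combination h0⟩
    have hdvd' : p ∣ ξ * p' := by exact_mod_cast hdvd
    rcases (hp.dvd_mul).1 hdvd' with h1 | h1
    · exact absurd (Nat.le_of_dvd hξ1 h1) (by omega)
    · obtain rfl := (Nat.prime_dvd_prime_iff_eq hp hp').1 h1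
      have hp00 : (p : ℤ) ≠ 0 := by exact_mod_cast hp.ne_zero
      have h2 : (ξ : ℤ) - ξ' = k * p := by
        apply mul_right_cancel₀ hp00
        linear_combination h0
      have hk : k = 0 := by
        by_contra hk
        have : (p : ℤ) ≤ |(ξ : ℤ) - ξ'| := by
          rw [h2, abs_mul, Nat.abs_cast]
          nlinarith [Int.one_le_abs hk]
        have h3 : |(ξ : ℤ) - ξ'| < p := abs_lt.2 ⟨by omega, by omega⟩
        omega
      rw [hk] at h2
      have : ξ = ξ' := by omega
      exact hne (by rw [this])
  have habs : (1 : ℝ) ≤ |((ξ * p' - ξ' * p - k * p * p' : ℤ) : ℝ)| := by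
    exact_mod_cast Int.one_le_abs hnum
  have heq : (ξ : ℝ) / p - (ξ' : ℝ) / p' - k
      = ((ξ * p' - ξ' * p - k * p * p' : ℤ) : ℝ) / (p * p') := by
    push_cast
    field_simp
  simp only [heq]
  rw [abs_div, abs_of_pos (mul_pos hp0 hp0')]
  refine div_le_div₀ (abs_nonneg _) habs (mul_pos hp0 hp0') ?_
  have : p * p' ≤ Q ^ 2 := by rw [sq]; exact Nat.mul_le_mul hpQ hpQ'
  exact_mod_cast this

theorem sum_range_expTwoPi_eq (p : ℕ) (hp : 0 < p) (k : ℤ) :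
    ∑ ξ ∈ Finset.range p, expTwoPi (k * ((ξ : ℝ) / p)) = if (p : ℤ) ∣ k then (p : ℂ) else 0 := by
  have hp0 : (p : ℝ) ≠ 0 := by exact_mod_cast hp.ne'
  have h1 : ∀ ξ : ℕ, expTwoPi (k * ((ξ : ℝ) / p)) = expTwoPi (k / p) ^ ξ := fun ξ => by
    rw [← expTwoPi_natCast_mul]
    congr 1
    ring
  simp only [h1]
  have hiff : expTwoPi (k / p) = 1 ↔ (p : ℤ) ∣ k := by
    rw [expTwoPi_eq_one_iff]
    refine exists_congr fun n => ?_
    rw [div_eq_iff hp0, mul_comm]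
    norm_cast
  split_ifs with h
  · rw [hiff.2 h]; simp
  · rw [geom_sum_eq fun h' => h (hiff.1 h'), ← expTwoPi_natCast_mul, mul_div_cancel₀ _ hp0,
      expTwoPi_intCast, sub_self, zero_div]

theorem modq_eq_sum (p : ℕ) {g : ℤ → ℝ} {S : Finset ℤ} (hS : ∀ x ∉ S, g x = 0) (x : ZMod p) :
    modq p g x = ∑ y ∈ S, if (y : ZMod p) = x then g y else 0 :=
  tsum_eq_sum fun y hy => by rw [hS y hy, ite_self]

theorem sum_modq (p : ℕ) [NeZero p] {g : ℤ → ℝ} {S : Finset ℤ} (hS : ∀ x ∉ S, g x = 0) :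
    ∑ x, modq p g x = ∑ y ∈ S, g y := by
  simp only [modq_eq_sum p hS]
  rw [Finset.sum_comm]
  exact Finset.sum_congr rfl fun y _ => by simp

/-- Parseval's identity for the reduction of `g` modulo `p`. -/
theorem parseval_modq (p : ℕ) [NeZero p] {g : ℤ → ℝ} {S : Finset ℤ} (hS : ∀ x ∉ S, g x = 0) :
    ∑ ξ ∈ Finset.range p, ‖∑ x ∈ S, (g x : ℂ) * expTwoPi (x * ((ξ : ℝ) / p))‖ ^ 2
      = p * ∑ x, modq p g x ^ 2 := by
  have hp : 0 < p := Nat.pos_of_ne_zero (NeZero.ne p)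
  have hL : ((∑ ξ ∈ Finset.range p, ‖∑ x ∈ S, (g x : ℂ) * expTwoPi (x * ((ξ : ℝ) / p))‖ ^ 2 : ℝ) : ℂ)
      = ∑ x ∈ S, ∑ y ∈ S, (g x : ℂ) * g y * if (p : ℤ) ∣ x - y then (p : ℂ) else 0 := by
    push_cast
    simp only [← sum_range_expTwoPi_eq p hp, Finset.mul_sum]
    rw [Finset.sum_congr rfl fun x _ => Finset.sum_comm, Finset.sum_comm]
    refine Finset.sum_congr rfl fun ξ _ => ?_
    rw [← Complex.mul_conj', map_sum, Finset.sum_mul_sum]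
    refine Finset.sum_congr rfl fun x _ => Finset.sum_congr rfl fun y _ => ?_
    push_cast
    rw [sub_mul, sub_eq_add_neg, expTwoPi_add, map_mul, conj_expTwoPi, Complex.conj_ofReal]
    ring
  have hR : ∑ x, modq p g x ^ 2 = ∑ x ∈ S, ∑ y ∈ S, g x * g y * if (p : ℤ) ∣ x - y then 1 else 0 := by
    simp only [modq_eq_sum p hS, sq, Finset.sum_mul_sum]
    rw [Finset.sum_comm]
    refine Finset.sum_congr rfl fun x _ => ?_
    rw [Finset.sum_comm]
    refine Finset.sum_congr rfl fun y _ => ?_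
    simp only [ite_mul, zero_mul]
    rw [Finset.sum_ite_eq, if_pos (Finset.mem_univ _)]
    have : (p : ℤ) ∣ x - y ↔ (y : ZMod p) = x := by
      rw [ZMod.intCast_eq_intCast_iff_dvd_sub]
    simp only [this]
    split_ifs <;> simp
  rw [hR]
  have h2 : ((p * ∑ x ∈ S, ∑ y ∈ S, g x * g y * (if (p : ℤ) ∣ x - y then (1 : ℝ) else 0) : ℝ) : ℂ)
      = ∑ x ∈ S, ∑ y ∈ S, (g x : ℂ) * g y * if (p : ℤ) ∣ x - y then (p : ℂ) else 0 := by
    push_cast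
    simp only [Finset.mul_sum]
    refine Finset.sum_congr rfl fun x _ => Finset.sum_congr rfl fun y _ => ?_
    split_ifs <;> simp
    ring
  exact_mod_cast hL.trans h2.symm

/-- The `ℓ¹` distance of `g mod p` from a multiple of the uniform measure is controlled by the
nontrivial Fourier coefficients. -/
theorem sq_sum_abs_modq_sub_le (p : ℕ) [NeZero p] {g : ℤ → ℝ} {S : Finset ℤ}
    (hS : ∀ x ∉ S, g x = 0) :
    (∑ x, |modq p g x - (∑ y ∈ S, g y) / p|) ^ 2
      ≤ ∑ ξ ∈ Finset.Ico 1 p, ‖∑ x ∈ S, (g x : ℂ) * expTwoPi (x * ((ξ : ℝ) / p))‖ ^ 2 := by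
  have hp : 0 < p := Nat.pos_of_ne_zero (NeZero.ne p)
  have hp0 : (p : ℝ) ≠ 0 := by exact_mod_cast hp.ne'
  have hpars := parseval_modq p hS
  rw [Finset.range_eq_Ico, Finset.sum_eq_sum_Ico_succ_bot hp] at hpars
  have h0 : ‖∑ x ∈ S, (g x : ℂ) * expTwoPi (x * (((0 : ℕ) : ℝ) / p))‖ ^ 2 = (∑ y ∈ S, g y) ^ 2 := by
    have h1 : expTwoPi 0 = 1 := by simpa using expTwoPi_intCast 0
    simp only [Nat.cast_zero, zero_div, mul_zero, h1, mul_one]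
    rw [← Complex.ofReal_sum, Complex.norm_real, Real.norm_eq_abs, sq_abs]
  rw [h0] at hpars
  have hCS := sq_sum_le_card_mul_sum_sq (s := (Finset.univ : Finset (ZMod p)))
    (f := fun x => |modq p g x - (∑ y ∈ S, g y) / p|)
  refine hCS.trans ?_
  simp only [sq_abs, sub_sq]
  rw [Finset.card_univ, ZMod.card, Finset.sum_add_distrib, Finset.sum_sub_distrib,
    ← Finset.sum_mul, ← Finset.mul_sum, sum_modq p hS, Finset.sum_const, Finset.card_univ,
    ZMod.card, nsmul_eq_mul]
  rw [zero_add] at hpars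
  refine le_of_eq ?_
  rw [← sub_eq_of_eq_add' hpars.symm]
  field_simp
  ring

theorem distUnif_eq_sum (p : ℕ) [NeZero p] (f : ℤ → ℝ) :
    distUnif p f = ∑ x, |modq p f x - 1 / p| := tsum_fintype _

theorem modq_step (a : ℤ) (p : ℕ) [Fact p.Prime] (hpa : (a : ZMod p) ≠ 0) {μ f : ℤ → ℝ}
    (hμ : IsFinProb μ) (hf : IsFinProb f) (x : ZMod p) :
    modq p (step a μ f) x = ∑ b ∈ hμ.finsupp.toFinset, μ b * modq p f ((x - b) * (a : ZMod p)⁻¹) := by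
  have hμs : ∀ b ∉ hμ.finsupp.toFinset, μ b = 0 := fun b hb => by simpa using hb
  calc modq p (step a μ f) x
      = ∑' z : ℤ, ∑' y : ℤ, if (z : ZMod p) = x then μ (z - a * y) * f y else 0 := by
        refine tsum_congr fun z => ?_
        split_ifs with h
        · rfl
        · exact tsum_zero.symm
    _ = ∑' y : ℤ, ∑' z : ℤ, if (z : ZMod p) = x then μ (z - a * y) * f y else 0 := by
        refine (Summable.tsum_comm ?_).symm
        apply summable_of_hasFiniteSupport
        refine (conv_uncurry_support_finite a hμ.finsupp hf.finsupp).subset ?_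
        rintro ⟨z, y⟩ h h'
        have h'' : μ (z - a * y) * f y = 0 := h'
        exact h (by simp [h''])
    _ = ∑' y : ℤ, ∑' b : ℤ, μ b * if (y : ZMod p) = (x - b) * (a : ZMod p)⁻¹ then f y else 0 := by
        refine tsum_congr fun y => ?_
        rw [← (Equiv.addRight (a * y)).tsum_eq]
        refine tsum_congr fun b => ?_
        have : ((b + a * y : ℤ) : ZMod p) = x ↔ (y : ZMod p) = (x - b) * (a : ZMod p)⁻¹ := by
          rw [eq_mul_inv_iff_mul_eq₀ hpa, eq_sub_iff_add_eq]
          push_cast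
          rw [add_comm, mul_comm]
        simp only [Equiv.coe_addRight, add_sub_cancel_right, this]
        split_ifs <;> simp
    _ = ∑' y : ℤ, ∑ b ∈ hμ.finsupp.toFinset,
          μ b * if (y : ZMod p) = (x - b) * (a : ZMod p)⁻¹ then f y else 0 :=
        tsum_congr fun y => tsum_eq_sum fun b hb => by rw [hμs b hb, zero_mul]
    _ = _ := by
        rw [Summable.tsum_finsetSum fun b _ => ?_]
        · simp only [tsum_mul_left, modq]
        · refine summable_of_hasFiniteSupport (hf.finsupp.subset fun y hy h => hy ?_)
          simp [h]

theorem distUnif_step_le (a : ℤ) (p : ℕ) [Fact p.Prime] (hpa : (a : ZMod p) ≠ 0) {μ f : ℤ → ℝ}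
    (hμ : IsFinProb μ) (hf : IsFinProb f) : distUnif p (step a μ f) ≤ distUnif p f := by
  rw [distUnif_eq_sum, distUnif_eq_sum]
  calc ∑ x, |modq p (step a μ f) x - 1 / p|
      ≤ ∑ x : ZMod p, ∑ b ∈ hμ.finsupp.toFinset,
          μ b * |modq p f ((x - b) * (a : ZMod p)⁻¹) - 1 / p| := by
        refine Finset.sum_le_sum fun x _ => ?_
        have h1 : modq p (step a μ f) x - 1 / p = ∑ b ∈ hμ.finsupp.toFinset,
            μ b * (modq p f ((x - b) * (a : ZMod p)⁻¹) - 1 / p) := by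
          simp only [mul_sub, Finset.sum_sub_distrib]
          rw [← Finset.sum_mul, hμ.sum_eq_one, one_mul, modq_step a p hpa hμ hf]
        rw [h1]
        refine (Finset.abs_sum_le_sum_abs _ _).trans_eq (Finset.sum_congr rfl fun b _ => ?_)
        rw [abs_mul, abs_of_nonneg (hμ.nonneg b)]
    _ = ∑ b ∈ hμ.finsupp.toFinset, μ b * ∑ x, |modq p f x - 1 / p| := by
        rw [Finset.sum_comm]
        refine Finset.sum_congr rfl fun b _ => ?_
        rw [← Finset.mul_sum]
        congr 1
        exact ((Equiv.subRight (b : ZMod p)).trans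
          (Equiv.mulRight₀ (a : ZMod p)⁻¹ (inv_ne_zero hpa))).sum_comp
          fun x => |modq p f x - 1 / p|
    _ = _ := by rw [← Finset.sum_mul, hμ.sum_eq_one, one_mul]

theorem distUnif_walk_antitone (a : ℤ) (p : ℕ) [Fact p.Prime] (hpa : (a : ZMod p) ≠ 0)
    {μ : ℤ → ℝ} (hμ : IsFinProb μ) : Antitone fun n => distUnif p (walk a μ n) :=
  antitone_nat_of_succ_le fun n => distUnif_step_le a p hpa hμ (walk_isFinProb a hμ n)

theorem exists_walk_support_bound {a : ℤ} (ha : 1 < a) {μ : ℤ → ℝ} (hμ : IsFinProb μ) :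
    ∃ C : ℕ, ∀ n : ℕ, ∀ x, walk a μ n x ≠ 0 → |x| ≤ C * a ^ n := by
  obtain ⟨C, hC⟩ : ∃ C : ℕ, ∀ x, μ x ≠ 0 → |x| ≤ (C : ℤ) := by
    obtain ⟨B, hB⟩ := (hμ.finsupp.image fun x => |x|).bddAbove
    exact ⟨B.toNat, fun x hx => (hB ⟨x, hx, rfl⟩).trans (Int.self_le_toNat B)⟩
  refine ⟨C, fun n x hx => ?_⟩
  suffices h : |x| ≤ C * (a ^ n - 1) by linarith [Int.natCast_nonneg C]
  induction n generalizing x with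
  | zero =>
    have : x = 0 := by simpa [walk] using hx
    simp [this]
  | succ n ih =>
    obtain ⟨y, hy⟩ : ∃ y, μ (x - a * y) * walk a μ n y ≠ 0 := by
      by_contra! h
      exact hx ((tsum_congr h).trans tsum_zero)
    have h1 := hC _ (left_ne_zero_of_mul hy)
    have h2 := ih y (right_ne_zero_of_mul hy)
    have h3 : |x| ≤ |x - a * y| + a * |y| := by
      have := abs_add_le (x - a * y) (a * y)
      rwa [sub_add_cancel, abs_mul, abs_of_pos (by linarith : 0 < a)] at this
    have h4 : a * |y| ≤ a * (C * (a ^ n - 1)) := mul_le_mul_of_nonneg_left h2 (by linarith)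
    have h5 : 0 ≤ (C : ℤ) * (a - 2) := mul_nonneg (Int.natCast_nonneg C) (by linarith)
    rw [pow_succ]
    linarith

theorem distUnif_le_add (p : ℕ) [NeZero p] {f : ℤ → ℝ} (hf : IsFinProb f) {S : Finset ℤ}
    (hS : ∀ x ∉ S, f x = 0) (c : ℝ) :
    distUnif p f ≤ ∑ x, |modq p (fun y => if c < f y then 0 else f y) x
        - (∑ y ∈ S, if c < f y then 0 else f y) / p|
      + 2 * ∑' y, if c < f y then f y else 0 := by
  have hp0 : (p : ℝ) ≠ 0 := by exact_mod_cast NeZero.ne p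
  have hSg : ∀ x ∉ S, (if c < f x then 0 else f x) = 0 := fun x hx => by rw [hS x hx, ite_self]
  have hSh : ∀ x ∉ S, (if c < f x then f x else 0) = 0 := fun x hx => by rw [hS x hx, ite_self]
  have hh0 : ∀ x, 0 ≤ if c < f x then f x else 0 := fun x => by
    split_ifs
    · exact hf.nonneg x
    · rfl
  have hsplit : ∀ y, f y = (if c < f y then 0 else f y) + if c < f y then f y else 0 := fun y => by
    split_ifs <;> simp
  have htot : (∑ y ∈ S, if c < f y then 0 else f y) + (∑ y ∈ S, if c < f y then f y else 0) = 1 := by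
    rw [← Finset.sum_add_distrib, ← hf.total, tsum_eq_sum hS]
    exact Finset.sum_congr rfl fun y _ => (hsplit y).symm
  rw [distUnif_eq_sum, tsum_eq_sum hSh]
  set G := ∑ y ∈ S, if c < f y then 0 else f y
  set h := fun y => if c < f y then f y else 0 with hh
  have hmod0 : ∀ x, 0 ≤ modq p h x := fun x => tsum_nonneg fun y => by
    split_ifs
    · exact hh0 y
    · rfl
  have hmodadd : ∀ x, modq p f x = modq p (fun y => if c < f y then 0 else f y) x + modq p h x := by
    intro x
    rw [modq_eq_sum p hS, modq_eq_sum p hSg, modq_eq_sum p hSh, ← Finset.sum_add_distrib]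
    refine Finset.sum_congr rfl fun y _ => ?_
    by_cases h1 : (y : ZMod p) = x
    · rw [if_pos h1, if_pos h1, if_pos h1]
      exact hsplit y
    · rw [if_neg h1, if_neg h1, if_neg h1, add_zero]
  have hsum : ∑ x, modq p h x = ∑ y ∈ S, h y := sum_modq p hSh
  have hHS : 0 ≤ ∑ y ∈ S, h y := Finset.sum_nonneg fun y _ => hh0 y
  calc ∑ x, |modq p f x - 1 / p|
      ≤ ∑ x, (|modq p (fun y => if c < f y then 0 else f y) x - G / p|
          + (modq p h x + (∑ y ∈ S, h y) / p)) := by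
        refine Finset.sum_le_sum fun x _ => ?_
        have : modq p f x - 1 / p = (modq p (fun y => if c < f y then 0 else f y) x - G / p)
            + (modq p h x - (∑ y ∈ S, h y) / p) := by
          rw [hmodadd, ← htot]; ring
        rw [this]
        refine (abs_add_le _ _).trans (add_le_add le_rfl ?_)
        refine (abs_sub _ _).trans_eq ?_
        rw [abs_of_nonneg (hmod0 x), abs_of_nonneg (by positivity)]
    _ = _ := by
        rw [Finset.sum_add_distrib, Finset.sum_add_distrib, hsum, Finset.sum_const,
          Finset.card_univ, ZMod.card, nsmul_eq_mul, mul_div_cancel₀ _ hp0]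
        ring

/-- Large sieve bound for the number of primes modulo which `f` is far from uniform. -/
theorem card_primes_distUnif_large_le {f : ℤ → ℝ} (hf : IsFinProb f) (P : Finset ℕ) (Q : ℕ)
    (hQ : 0 < Q) (hP : ∀ p ∈ P, p.Prime ∧ p ≤ Q) (M : ℕ) (hM : ∀ x, f x ≠ 0 → |x| ≤ M)
    {c ε : ℝ} (hε : 0 ≤ ε) (hc0 : 0 ≤ c)
    (hc : ∑' y, (if c < f y then f y else 0) ≤ ε / 4) (hPε : ∀ p ∈ P, ε < distUnif p f) :
    P.card * (ε / 2) ^ 2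
      ≤ ((2 * M + 1) + 2 * ((Q ^ 2 : ℕ) * (1 + Real.log (Q ^ 2 : ℕ)))) * c := by
  have hS : ∀ x ∉ Finset.Icc (-M : ℤ) M, f x = 0 := fun x hx => by
    by_contra h
    exact hx (Finset.mem_Icc.2 (abs_le.1 (hM x h)))
  set g : ℤ → ℝ := fun y => if c < f y then 0 else f y with hg
  have hSg : ∀ x ∉ Finset.Icc (-M : ℤ) M, g x = 0 := fun x hx => by
    simp only [hg]; rw [hS x hx, ite_self]
  have htot : ∑' x, f x = ∑ x ∈ Finset.Icc (-M : ℤ) M, f x := tsum_eq_sum hS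
  calc P.card * (ε / 2) ^ 2 = ∑ p ∈ P, (ε / 2) ^ 2 := by rw [Finset.sum_const, nsmul_eq_mul]
    _ ≤ ∑ p ∈ P, ∑ ξ ∈ Finset.Ico 1 p,
        ‖∑ x ∈ Finset.Icc (-M : ℤ) M, (g x : ℂ) * expTwoPi (x * ((ξ : ℝ) / p))‖ ^ 2 := by
        refine Finset.sum_le_sum fun p hp => ?_
        have : NeZero p := ⟨(hP p hp).1.ne_zero⟩
        refine le_trans ?_ (sq_sum_abs_modq_sub_le p hSg)
        have := distUnif_le_add p hf hS c
        refine pow_le_pow_left₀ (by linarith) ?_ 2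
        linarith [hPε p hp]
    _ ≤ _ := large_sieve_primes P Q hQ hP M g
    _ ≤ _ := by
        have hlog : 0 ≤ Real.log (Q ^ 2 : ℕ) := Real.log_natCast_nonneg _
        refine mul_le_mul_of_nonneg_left ?_ (by positivity)
        calc ∑ x ∈ Finset.Icc (-M : ℤ) M, g x ^ 2
            ≤ ∑ x ∈ Finset.Icc (-M : ℤ) M, c * f x := by
              refine Finset.sum_le_sum fun x _ => ?_
              have := hf.nonneg x
              simp only [hg]
              split_ifs with h
              · rw [zero_pow two_ne_zero]; positivity
              · rw [sq]
                exact mul_le_mul_of_nonneg_right (not_lt.1 h) this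
          _ = c := by rw [← Finset.mul_sum, ← htot, hf.total, mul_one]

open Filter in
theorem eventually_exp_div_le_primeCounting :
    ∀ᶠ y : ℝ in atTop, Real.exp y / (2 * y) ≤ Nat.primeCounting ⌊Real.exp y⌋₊ := by
  filter_upwards [eventually_ge_atTop 20] with y hy
  have hy0 : 0 < y := by linarith
  have h1 := Chebyshev.pi_ge' (Real.one_lt_exp_iff.2 hy0)
  rw [Real.log_exp] at h1
  refine le_trans ?_ h1
  have hq := Real.quadratic_le_exp_of_nonneg hy0.le
  have h2 : Real.log (Real.exp y + 2) ≤ y + 2 := by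
    calc Real.log (Real.exp y + 2) ≤ Real.log (3 * Real.exp y) :=
          Real.log_le_log (by positivity) (by nlinarith)
      _ = Real.log 3 + y := by rw [Real.log_mul (by norm_num) (Real.exp_pos y).ne', Real.log_exp]
      _ ≤ _ := by linarith [Real.log_le_sub_one_of_pos (by norm_num : (0 : ℝ) < 3)]
  rw [div_le_div_iff₀ (by positivity) hy0]
  have h3 := Real.log_two_gt_d9
  have h4 : Real.exp y ≤ 2 * ((Real.exp y - 1) * Real.log 2 - Real.log (Real.exp y + 2)) := by
    nlinarith
  nlinarith

open Filter in
theorem eventually_add_mul_exp_le (A K D : ℝ) {σ ε : ℝ} (hσ : 0 < σ) (hε : 0 < ε) :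
    ∀ᶠ y : ℝ in atTop,
      A + K * (Real.exp (y - σ * y) * (D + 4 * y)) ≤ ε * (Real.exp y / (2 * y)) := by
  have hA := tendsto_rpow_mul_exp_neg_mul_atTop_nhds_zero 1 1 one_pos
  have h1 := tendsto_rpow_mul_exp_neg_mul_atTop_nhds_zero 1 σ hσ
  have h2 := tendsto_rpow_mul_exp_neg_mul_atTop_nhds_zero 2 σ hσ
  have hlim := ((hA.const_mul A).add (h1.const_mul (K * D))).add (h2.const_mul (K * 4))
  simp only [mul_zero, add_zero] at hlim
  filter_upwards [hlim.eventually_lt_const (half_pos hε), eventually_gt_atTop 0] with y hy hy0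
  rw [← mul_div_assoc, le_div_iff₀ (by positivity)]
  have hexp : 0 < Real.exp y := Real.exp_pos y
  have h3 := mul_le_mul_of_nonneg_left hy.le (by positivity : 0 ≤ 2 * Real.exp y)
  rw [Real.rpow_one, Real.rpow_two, neg_one_mul] at h3
  have h4 : Real.exp y * Real.exp (-y) = 1 := by rw [← Real.exp_add, add_neg_cancel, Real.exp_zero]
  have h5 : Real.exp (y - σ * y) = Real.exp y * Real.exp (-σ * y) := by
    rw [← Real.exp_add]; ring_nf
  rw [h5]
  have h6 : 2 * Real.exp y * (A * (y * Real.exp (-y))) = 2 * A * y := by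
    linear_combination (2 * A * y) * h4
  linarith

theorem filter_primes_log_le_eq {y : ℝ} :
    (Finset.range (⌈Real.exp y⌉₊ + 1)).filter (fun p : ℕ => p.Prime ∧ Real.log p ≤ y)
      = Nat.primesLE ⌊Real.exp y⌋₊ := by
  ext p
  rw [Finset.mem_filter, Nat.mem_primesLE, Finset.mem_range]
  have hiff : p.Prime → (Real.log p ≤ y ↔ p ≤ ⌊Real.exp y⌋₊) := fun hp => by
    rw [Nat.le_floor_iff (Real.exp_pos y).le,
      Real.log_le_iff_le_exp (by exact_mod_cast hp.pos)]
  constructor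
  · rintro ⟨-, hp, h⟩
    exact ⟨(hiff hp).1 h, hp⟩
  · rintro ⟨h, hp⟩
    exact ⟨Nat.lt_succ_of_le (h.trans (Nat.floor_le_ceil _)), hp, (hiff hp).2 h⟩

/-- assume `H > (1/2)·log a`. For every `δ, ε > 0` there is `N` such that for all
`n ≥ N`, the number of primes `p` with `log p ≤ (1−δ)·H·n` and `‖μ_n mod p − u_p‖ > ε` is at
most `ε` times the total number of primes `p` with `log p ≤ (1−δ)·H·n`. -/
theorem stmt1 (a : ℤ) (ha : 1 < a) (μ : ℤ → ℝ) (hμ : IsGoodMeasure μ) (H : ℝ)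
    (hH : Filter.Tendsto (fun n : ℕ => entropy (walk a μ n) / n) Filter.atTop (nhds H))
    (hHa : Real.log a / 2 < H)
    (δ ε : ℝ) (hδ : 0 < δ) (hε : 0 < ε) :
    ∃ N : ℕ, ∀ n : ℕ, N ≤ n →
      (((Finset.range (⌈Real.exp ((1 - δ) * H * n)⌉₊ + 1)).filter
          (fun p : ℕ => p.Prime ∧ Real.log p ≤ (1 - δ) * H * n ∧
            ε < distUnif p (walk a μ n))).card : ℝ)
        ≤ ε * (((Finset.range (⌈Real.exp ((1 - δ) * H * n)⌉₊ + 1)).filter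
          (fun p : ℕ => p.Prime ∧ Real.log p ≤ (1 - δ) * H * n)).card : ℝ) := by
  have hμ' : IsFinProb μ := ⟨hμ.nonneg, hμ.finsupp, hμ.total⟩
  have ha1 : (1 : ℝ) < a := by exact_mod_cast ha
  have hla : 0 < Real.log a := Real.log_pos ha1
  have hH0 : 0 < H := by linarith
  rcases le_or_gt 1 δ with hδ1 | hδ1
  · refine ⟨0, fun n _ => ?_⟩
    rw [Finset.filter_eq_empty_iff.2, Finset.card_empty, Nat.cast_zero]
    · positivity
    · rintro p - ⟨hp, hlog, -⟩
      have h1 : 0 < Real.log p := Real.log_pos (by exact_mod_cast hp.one_lt)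
      have h2 : (1 - δ) * H * n ≤ 0 :=
        mul_nonpos_of_nonpos_of_nonneg (mul_nonpos_of_nonpos_of_nonneg (by linarith) hH0.le)
          (Nat.cast_nonneg n)
      linarith
  set δ' := min δ (1 - Real.log a / (2 * H)) with hδ'
  have hδ'δ : δ' ≤ δ := min_le_left _ _
  have hδ'0 : 0 < δ' := lt_min hδ (by rw [sub_pos, div_lt_one (by positivity)]; linarith)
  have hδ'a : Real.log a / 2 ≤ (1 - δ') * H := by
    have h1 : Real.log a / (2 * H) ≤ 1 - δ' := by
      linarith [min_le_right δ (1 - Real.log a / (2 * H))]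
    calc Real.log a / 2 = Real.log a / (2 * H) * H := by field_simp
      _ ≤ _ := by gcongr
  set h := (1 - δ') * H with hh
  have hh0 : 0 < h := by linarith
  set t := δ' * H / 2 with ht
  have ht0 : 0 < t := by positivity
  set σ := (H - t) / h - 1 with hσ
  have hσ0 : 0 < σ := by
    rw [hσ, sub_pos, one_lt_div hh0, hh, ht]
    nlinarith
  obtain ⟨C, hC⟩ := exists_walk_support_bound ha hμ'
  obtain ⟨N₀, hN₀⟩ := Filter.eventually_atTop.1
    (eventually_tsum_large_le a hμ' hH0.le hH ht0 (by positivity : 0 < ε / 4))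
  have hy_tendsto : Filter.Tendsto (fun n : ℕ => (1 - δ) * H * n) Filter.atTop Filter.atTop :=
    tendsto_natCast_atTop_atTop.const_mul_atTop (mul_pos (by linarith) hH0)
  set D := (2 * C + 1) * Real.exp (2 * h) + 2 with hD
  have hev := (eventually_exp_div_le_primeCounting.and
    ((eventually_add_mul_exp_le (a.toNat + 1) (1 / (ε / 2) ^ 2) D hσ0 hε).and
      (Filter.eventually_ge_atTop (h * N₀)))).and (Filter.eventually_gt_atTop 0)
  obtain ⟨N, hN⟩ := Filter.eventually_atTop.1 (hy_tendsto.eventually hev)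
  refine ⟨N, fun n hn => ?_⟩
  obtain ⟨⟨hpi, hasym, hyN₀⟩, hy0⟩ := hN n hn
  set y := (1 - δ) * H * n with hy
  set Q := ⌊Real.exp y⌋₊ with hQ
  have hQ0 : 0 < Q := Nat.floor_pos.2 (Real.one_le_exp hy0.le)
  have hQ0' : (0 : ℝ) < Q := by exact_mod_cast hQ0
  have hQle : (Q : ℝ) ≤ Real.exp y := Nat.floor_le (Real.exp_pos y).le
  have hlogQ : Real.log Q ≤ y := (Real.log_le_iff_le_exp hQ0').2 hQle
  set m := ⌈y / h⌉₊ with hm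
  have hmy : y ≤ h * m := by
    rw [← div_le_iff₀' hh0]; exact Nat.le_ceil _
  have hmy' : h * m ≤ y + h := by
    have := (Nat.ceil_lt_add_one (by positivity : 0 ≤ y / h)).le
    calc h * m ≤ h * (y / h + 1) := by gcongr
      _ = y + h := by field_simp
  have hmn : m ≤ n := by
    rw [hm, Nat.ceil_le, div_le_iff₀' hh0, hy, hh]
    gcongr
  have hmN₀ : N₀ ≤ m := by
    have : h * N₀ ≤ h * m := hyN₀.trans hmy
    exact_mod_cast le_of_mul_le_mul_left this hh0
  rw [filter_primes_log_le_eq, Nat.primesLE_card_eq_primeCounting]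
  set Bad := (Nat.primesLE Q).filter (fun p => ε < distUnif p (walk a μ m)) with hBad
  have hsub : (Finset.range (⌈Real.exp y⌉₊ + 1)).filter
      (fun p : ℕ => p.Prime ∧ Real.log p ≤ y ∧ ε < distUnif p (walk a μ n))
      ⊆ Finset.range (a.toNat + 1) ∪ Bad := by
    intro p hp
    obtain ⟨hpr, hp, hlog, hdist⟩ := Finset.mem_filter.1 hp
    rw [Finset.mem_union]
    have : Fact p.Prime := ⟨hp⟩
    by_cases hpa : (a : ZMod p) = 0
    · left
      rw [ZMod.intCast_zmod_eq_zero_iff_dvd] at hpa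
      have := Int.le_of_dvd (by linarith) hpa
      rw [Finset.mem_range]
      omega
    · right
      refine Finset.mem_filter.2 ⟨?_, hdist.trans_le (distUnif_walk_antitone a p hpa hμ' hmn)⟩
      rw [hQ, ← filter_primes_log_le_eq]
      exact Finset.mem_filter.2 ⟨hpr, hp, hlog⟩
  have hcard := (Finset.card_le_card hsub).trans (Finset.card_union_le _ _)
  rw [Finset.card_range] at hcard
  have hcard' : (((Finset.range (⌈Real.exp y⌉₊ + 1)).filter
      (fun p : ℕ => p.Prime ∧ Real.log p ≤ y ∧ ε < distUnif p (walk a μ n))).card : ℝ)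
      ≤ (a.toNat + 1) + Bad.card := by exact_mod_cast hcard
  have hsieve := card_primes_distUnif_large_le (walk_isFinProb a hμ' m) Bad Q hQ0
    (fun p hp => (Nat.mem_primesLE.1 (Finset.mem_filter.1 hp).1).symm) (C * a.toNat ^ m)
    (fun x hx => by
      have := hC m x hx
      rwa [← Int.toNat_of_nonneg (by linarith : 0 ≤ a)] at this)
    hε.le (Real.exp_pos _).le (hN₀ m hmN₀) (fun p hp => (Finset.mem_filter.1 hp).2)
  have hc : Real.exp (-((H - t) * m)) ≤ Real.exp (-((1 + σ) * y)) := by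
    have hHt : 0 ≤ (H - t) / h := by linarith
    have h1 := mul_le_mul_of_nonneg_left hmy hHt
    have h2 : (H - t) / h * (h * m) = (H - t) * m := by field_simp
    rw [Real.exp_le_exp, neg_le_neg_iff, ← h2, hσ]
    linarith
  have hpow : (a.toNat : ℝ) ^ m ≤ Real.exp (2 * h) * Real.exp (2 * y) := by
    have h1 : (a.toNat : ℝ) = a := by exact_mod_cast Int.toNat_of_nonneg (by linarith : 0 ≤ a)
    rw [h1, ← Real.exp_log (by linarith : (0 : ℝ) < a), ← Real.exp_nat_mul, ← Real.exp_add,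
      Real.exp_le_exp]
    have h2 : Real.log a * m ≤ 2 * h * m := by gcongr; linarith
    linarith
  have hpow1 : (1 : ℝ) ≤ Real.exp (2 * h) * Real.exp (2 * y) := by
    rw [← Real.exp_add]; exact Real.one_le_exp (by positivity)
  have hfactor : (2 * ((C * a.toNat ^ m : ℕ) : ℝ) + 1)
        + 2 * ((Q ^ 2 : ℕ) * (1 + Real.log (Q ^ 2 : ℕ)))
      ≤ Real.exp (2 * y) * (D + 4 * y) := by
    push_cast
    rw [Real.log_pow]
    have h1 : (Q : ℝ) ^ 2 ≤ Real.exp (2 * y) := by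
      rw [two_mul, Real.exp_add, ← sq]
      exact pow_le_pow_left₀ hQ0'.le hQle 2
    have h2 : (Q : ℝ) ^ 2 * (1 + (2 : ℕ) * Real.log Q) ≤ Real.exp (2 * y) * (1 + (2 : ℕ) * y) := by
      have : 0 ≤ Real.log Q := Real.log_natCast_nonneg Q
      gcongr
    have h3 : (C : ℝ) * a.toNat ^ m ≤ C * (Real.exp (2 * h) * Real.exp (2 * y)) := by gcongr
    push_cast at h2
    rw [hD]
    push_cast
    linarith
  have hbad : (Bad.card : ℝ) ≤ 1 / (ε / 2) ^ 2 * (Real.exp (y - σ * y) * (D + 4 * y)) := by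
    rw [one_div, inv_mul_eq_div, le_div_iff₀ (by positivity)]
    refine hsieve.trans ?_
    calc _ ≤ Real.exp (2 * y) * (D + 4 * y) * Real.exp (-((1 + σ) * y)) := by
          refine mul_le_mul hfactor hc (Real.exp_pos _).le ?_
          positivity
      _ = _ := by
          rw [mul_right_comm, ← Real.exp_add]
          ring_nf
  calc _ ≤ _ := hcard'
    _ ≤ _ := add_le_add le_rfl hbad
    _ ≤ _ := hasym
    _ ≤ _ := by gcongr
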